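/- For every symmetric convex body K ⊂ ℝ², C(K) ≥ 144. Moreover C([−1,1]²) = 144. -/

import Mathlib

open MeasureTheory Set

/-- Coordinates of a point of `ℝ²`. -/
noncomputable def coord2 (i : Fin 2) (q : ℝ × ℝ) : ℝ := if i = 0 then q.1 else q.2

/-- The barycenter coordinates of `A ⊆ ℝ²`. -/
noncomputable def bary2 (A : Set (ℝ × ℝ)) (i : Fin 2) : ℝ :=
  (∫ q in A, coord2 i q) / (volume A).toReal

/-- The covariance matrix of `A ⊆ ℝ²`. -/
noncomputable def cov2 (A : Set (ℝ × ℝ)) : Matrix (Fin 2) (Fin 2) ℝ :=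
  Matrix.of fun i j =>
    (∫ q in A, coord2 i q * coord2 j q) / (volume A).toReal - bary2 A i * bary2 A j

/-- The affine invariant `C(A) = |A|² / det Cov(A)`, the inverse `2n`-th power of the
isotropic constant. -/
noncomputable def isoC (A : Set (ℝ × ℝ)) : ℝ := (volume A).toReal ^ 2 / (cov2 A).det


theorem volume_affine_line_eq_zero {a b : ℝ} (c : ℝ) (h : a ^ 2 + b ^ 2 ≠ 0) :
    volume {q : ℝ × ℝ | a * q.1 + b * q.2 = c} = 0 := by
  let l : ℝ × ℝ →ₗ[ℝ] ℝ := a • LinearMap.fst ℝ ℝ ℝ + b • LinearMap.snd ℝ ℝ ℝ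
  have hl : ∀ q, l q = a * q.1 + b * q.2 := fun q => by simp [l]
  have hker : volume ((LinearMap.ker l : Submodule ℝ (ℝ × ℝ)) : Set (ℝ × ℝ)) = 0 := by
    apply Measure.addHaar_submodule
    intro htop
    have : l (a, b) = 0 := by
      rw [← LinearMap.mem_ker, htop]; trivial
    rw [hl] at this
    apply h
    linarith
  have hset : {q : ℝ × ℝ | a * q.1 + b * q.2 = c} =
      (fun q => q + (-(c / (a ^ 2 + b ^ 2)) • ((a, b) : ℝ × ℝ))) ⁻¹'
        ((LinearMap.ker l : Submodule ℝ (ℝ × ℝ)) : Set (ℝ × ℝ)) := by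
    ext q
    simp only [mem_ofPred_eq, mem_preimage, SetLike.mem_coe, LinearMap.mem_ker, hl,
      Prod.fst_add, Prod.snd_add, Prod.smul_fst, Prod.smul_snd, smul_eq_mul]
    have : a * (q.1 + -(c / (a ^ 2 + b ^ 2)) * a) + b * (q.2 + -(c / (a ^ 2 + b ^ 2)) * b) =
        a * q.1 + b * q.2 - c := by
      field_simp
      ring
    rw [this, sub_eq_zero]
  rw [hset, measure_preimage_add_right, hker]

theorem setIntegral_eq_add_of_line {K : Set (ℝ × ℝ)} (hK : IsCompact K) {F : ℝ × ℝ → ℝ}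
    (hF : Continuous F) {a b : ℝ} (c : ℝ) (h : a ^ 2 + b ^ 2 ≠ 0) :
    ∫ q in K, F q = (∫ q in K ∩ {q | c ≤ a * q.1 + b * q.2}, F q) +
      ∫ q in K ∩ {q | a * q.1 + b * q.2 ≤ c}, F q := by
  have hS : MeasurableSet {q : ℝ × ℝ | c ≤ a * q.1 + b * q.2} :=
    (isClosed_le (by fun_prop) (by fun_prop)).measurableSet
  rw [← integral_inter_add_sdiff hS (hF.continuousOn.integrableOn_compact hK)]
  congr 1
  apply setIntegral_congr_set
  have hn : ∀ᵐ q : ℝ × ℝ, q ∉ {q : ℝ × ℝ | a * q.1 + b * q.2 = c} :=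
    measure_eq_zero_iff_ae_notMem.1 (volume_affine_line_eq_zero c h)
  rw [Filter.eventuallyEq_set]
  filter_upwards [hn] with q hq
  rw [mem_sdiff, mem_inter_iff, mem_ofPred_eq, mem_ofPred_eq, not_le]
  exact and_congr_right fun _ => ⟨le_of_lt, fun h' => lt_of_le_of_ne h' hq⟩

theorem setIntegral_linear_change {a b c d : ℝ} (hD : a * d - b * c ≠ 0) (K : Set (ℝ × ℝ))
    (F : ℝ × ℝ → ℝ) (s t : ℝ) :
    ∫ q in K, F q = |a * d - b * c| *
      ∫ q in (fun q : ℝ × ℝ => (a * q.1 + b * q.2 + s, c * q.1 + d * q.2 + t)) ⁻¹' K,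
        F (a * q.1 + b * q.2 + s, c * q.1 + d * q.2 + t) := by
  let L := Matrix.toLin (Module.Basis.finTwoProd ℝ) (Module.Basis.finTwoProd ℝ) !![a, b; c, d]
  have hL : ∀ q, L q = (a * q.1 + b * q.2, c * q.1 + d * q.2) := fun q =>
    Matrix.toLin_finTwoProd_apply a b c d q
  have hdet : LinearMap.det L = a * d - b * c := by
    simp [L, Matrix.det_fin_two_of]
  have hmap := Measure.map_linearMap_addHaar_eq_smul_addHaar (volume : Measure (ℝ × ℝ))
    (f := L) (by rw [hdet]; exact hD)
  have hLc : Continuous L := L.continuous_of_finiteDimensional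
  have hLi : Function.Injective L := by
    exact (LinearMap.equivOfDetNeZero L (by rw [hdet]; exact hD)).injective
  have hemb : MeasurableEmbedding L := hLc.measurableEmbedding hLi
  have h1 := hemb.setIntegral_map (μ := volume) (fun q => F (q + (s, t)))
    ((fun q => q + (s, t)) ⁻¹' K)
  rw [hmap, Measure.restrict_smul, integral_smul_measure, hdet] at h1
  have h2 := (measurePreserving_add_right (volume : Measure (ℝ × ℝ)) (s, t)).setIntegral_preimage_emb
    (measurableEmbedding_addRight (s, t)) F K
  rw [h2] at h1
  have h3 : (fun q : ℝ × ℝ => (a * q.1 + b * q.2 + s, c * q.1 + d * q.2 + t)) =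
      fun q => L q + (s, t) := by
    funext q; simp [hL]
  have h4 : (fun q : ℝ × ℝ => F (a * q.1 + b * q.2 + s, c * q.1 + d * q.2 + t)) =
      fun q => F (L q + (s, t)) := by
    funext q; simp [hL]
  rw [h3, h4]
  rw [← preimage_comp] at h1
  change _ = |a * d - b * c| * ∫ q in ((fun q => q + (s, t)) ∘ L) ⁻¹' K, F (L q + (s, t))
  rw [← h1, ENNReal.toReal_ofReal (abs_nonneg _), smul_eq_mul, abs_inv, ← mul_assoc,
    mul_inv_cancel₀ (abs_ne_zero.2 hD), one_mul]

theorem setIntegral_eq_integral_section {R : Set (ℝ × ℝ)} (hR : IsCompact R) {F : ℝ × ℝ → ℝ}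
    (hF : Continuous F) :
    ∫ q in R, F q = ∫ x, ∫ y in {y | (x, y) ∈ R}, F (x, y) := by
  have hi : Integrable (R.indicator F) (volume.prod volume) :=
    (integrable_indicator_iff hR.measurableSet).2 (hF.continuousOn.integrableOn_compact hR)
  rw [← integral_indicator hR.measurableSet, Measure.volume_eq_prod, integral_prod _ hi]
  congr 1
  funext x
  have hm : MeasurableSet {y | (x, y) ∈ R} := measurable_prodMk_left hR.measurableSet
  rw [← integral_indicator hm]
  rfl

theorem setIntegral_eq_integral_section_symm {R : Set (ℝ × ℝ)} (hR : IsCompact R)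
    {F : ℝ × ℝ → ℝ} (hF : Continuous F) :
    ∫ q in R, F q = ∫ y, ∫ x in {x | (x, y) ∈ R}, F (x, y) := by
  have hi : Integrable (R.indicator F) (volume.prod volume) :=
    (integrable_indicator_iff hR.measurableSet).2 (hF.continuousOn.integrableOn_compact hR)
  rw [← integral_indicator hR.measurableSet, Measure.volume_eq_prod, integral_prod_symm _ hi]
  congr 1
  funext y
  have hm : MeasurableSet {x | (x, y) ∈ R} := measurable_prodMk_right hR.measurableSet
  rw [← integral_indicator hm]
  rfl

theorem integrable_section_symm {R : Set (ℝ × ℝ)} (hR : IsCompact R) {F : ℝ × ℝ → ℝ}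
    (hF : Continuous F) : Integrable fun y : ℝ => ∫ x in {x | (x, y) ∈ R}, F (x, y) := by
  have hi : Integrable (R.indicator F) (volume.prod volume) :=
    (integrable_indicator_iff hR.measurableSet).2 (hF.continuousOn.integrableOn_compact hR)
  refine hi.integral_prod_right.congr (Filter.Eventually.of_forall fun y => ?_)
  have hm : MeasurableSet {x | (x, y) ∈ R} := measurable_prodMk_right hR.measurableSet
  change ∫ x, R.indicator F (x, y) = ∫ x in {x | (x, y) ∈ R}, F (x, y)
  rw [← integral_indicator hm]
  rfl

theorem setIntegral_of_section_Icc {R : Set (ℝ × ℝ)} (hR : IsCompact R) {f : ℝ → ℝ}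
    (hf : ∀ x ∈ Icc (0 : ℝ) 1, 0 ≤ f x)
    (hRf : ∀ x y, (x, y) ∈ R ↔ x ∈ Icc (0 : ℝ) 1 ∧ y ∈ Icc 0 (f x)) {F : ℝ × ℝ → ℝ}
    (hF : Continuous F) :
    ∫ q in R, F q = ∫ x in (0 : ℝ)..1, ∫ y in (0 : ℝ)..f x, F (x, y) := by
  rw [setIntegral_eq_integral_section hR hF, intervalIntegral.integral_of_le zero_le_one,
    ← integral_Icc_eq_integral_Ioc,
    ← setIntegral_eq_integral_of_forall_compl_eq_zero (s := Icc (0 : ℝ) 1)]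
  · refine setIntegral_congr_fun measurableSet_Icc fun x hx => ?_
    have : {y | (x, y) ∈ R} = Icc 0 (f x) := by
      ext y
      exact (hRf x y).trans (and_iff_right hx)
    rw [this, intervalIntegral.integral_of_le (hf x hx), integral_Icc_eq_integral_Ioc]
  · intro x hx
    have : {y | (x, y) ∈ R} = ∅ := by
      ext y
      exact iff_of_false (fun h => hx ((hRf x y).1 h).1) (fun h => h)
    rw [this, setIntegral_empty]

theorem integral_cubic (a b c₀ c₁ c₂ c₃ : ℝ) :
    ∫ x in a..b, (c₀ + c₁ * x + c₂ * x ^ 2 + c₃ * x ^ 3) =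
      c₀ * (b - a) + c₁ * (b ^ 2 - a ^ 2) / 2 + c₂ * (b ^ 3 - a ^ 3) / 3 +
        c₃ * (b ^ 4 - a ^ 4) / 4 := by
  have h : ∀ x ∈ uIcc a b, HasDerivAt
      (fun x : ℝ => c₀ * x + c₁ * x ^ 2 / 2 + c₂ * x ^ 3 / 3 + c₃ * x ^ 4 / 4)
      (c₀ + c₁ * x + c₂ * x ^ 2 + c₃ * x ^ 3) x := by
    intro x _
    have h1 := (hasDerivAt_id x).const_mul c₀
    have h2 := ((hasDerivAt_pow 2 x).const_mul c₁).div_const 2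
    have h3 := ((hasDerivAt_pow 3 x).const_mul c₂).div_const 3
    have h4 := ((hasDerivAt_pow 4 x).const_mul c₃).div_const 4
    refine (((h1.add h2).add h3).add h4).congr_deriv ?_
    norm_num
    ring
  rw [intervalIntegral.integral_eq_sub_of_hasDerivAt h
    (Continuous.intervalIntegrable (by fun_prop) _ _)]
  ring

theorem ConcaveOn.three_point {s : Set ℝ} {f : ℝ → ℝ} (hf : ConcaveOn ℝ s f) {u v w : ℝ}
    (hu : u ∈ s) (hw : w ∈ s) (huv : u ≤ v) (hvw : v ≤ w) :
    (w - v) * f u + (v - u) * f w ≤ (w - u) * f v := by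
  rcases huv.eq_or_lt with rfl | huv'
  · linarith
  have hd : 0 < w - u := by linarith
  have h := hf.2 hu hw (div_nonneg (sub_nonneg.2 hvw) hd.le) (div_nonneg (sub_nonneg.2 huv) hd.le)
    (by rw [← add_div, div_eq_one_iff_eq hd.ne']; ring)
  simp only [smul_eq_mul] at h
  have he : (w - v) / (w - u) * u + (v - u) / (w - u) * w = v := by
    rw [div_mul_eq_mul_div, div_mul_eq_mul_div, ← add_div, div_eq_iff hd.ne']
    ring
  rw [he, div_mul_eq_mul_div, div_mul_eq_mul_div, ← add_div, div_le_iff₀ hd] at h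
  linarith

/-- Among concave functions below the two given slopes, the second moment about the centre of
`[0, 1]` cannot be too large. -/
theorem concave_moment_ge {f : ℝ → ℝ} (hf : ConcaveOn ℝ (Icc (0 : ℝ) 1) f)
    (hfi : IntervalIntegrable f volume 0 1) {m n k : ℝ}
    (hm : ∀ x ∈ Icc (0 : ℝ) 1, f x ≤ m * x) (hn : ∀ x ∈ Icc (0 : ℝ) 1, f x ≤ n * (1 - x))
    (hk : 0 < k) (hk2 : k ≤ 1 / 2) (hmn : k * (m + n) ≤ 1)
    (hI : ∫ x in (0 : ℝ)..1, f x = k / 2) :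
    k + k ^ 3 ≤ ∫ x in (0 : ℝ)..1, f x * (12 * x * (1 - x)) := by
  obtain ⟨r, hr0, hr2⟩ : ∃ r : ℝ, 0 ≤ r ∧ r ^ 2 = 1 - 4 * k ^ 2 :=
    ⟨√(1 - 4 * k ^ 2), Real.sqrt_nonneg _, Real.sq_sqrt (by nlinarith)⟩
  obtain ⟨j, hj0, hj2⟩ : ∃ j : ℝ, 0 ≤ j ∧ j ^ 2 = r ^ 2 / 12 :=
    ⟨√(r ^ 2 / 12), Real.sqrt_nonneg _, Real.sq_sqrt (by positivity)⟩
  have hr1 : r < 1 := by nlinarith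
  have hjr : j ≤ r / 2 := by nlinarith
  set z := (1 - r) / 2 with hz
  have hrz : r = 1 - 2 * z := by rw [hz]; ring
  have hz0 : 0 < z := by rw [hz]; linarith
  have hz1 : z ≤ 1 / 2 := by rw [hz]; linarith
  have hzk : z * (1 - z) = k ^ 2 := by rw [hz]; nlinarith
  have chord : ∃ A B : ℝ, ∀ x ∈ Icc z (1 - z),
      f x * (12 * (x - 1 / 2) ^ 2 - r ^ 2) ≤
        (A + B * (x - 1 / 2)) * (12 * (x - 1 / 2) ^ 2 - r ^ 2) := by
    rcases hr0.eq_or_lt with hr | hr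
    · refine ⟨0, 0, fun x hx => ?_⟩
      have : x = 1 / 2 := by linarith [hx.1, hx.2]
      rw [this, ← hr]
      norm_num
    have hj : 0 < j := by
      rcases hj0.eq_or_lt with h | h
      · rw [← h] at hj2
        nlinarith
      · exact h
    have hmem1 : 1 / 2 - j ∈ Icc (0 : ℝ) 1 := ⟨by linarith, by linarith⟩
    have hmem2 : 1 / 2 + j ∈ Icc (0 : ℝ) 1 := ⟨by linarith, by linarith⟩
    refine ⟨(f (1 / 2 - j) + f (1 / 2 + j)) / 2, (f (1 / 2 + j) - f (1 / 2 - j)) / (2 * j),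
      fun x hx => ?_⟩
    have hx01 : x ∈ Icc (0 : ℝ) 1 := ⟨by linarith [hx.1], by linarith [hx.2]⟩
    set P := f (1 / 2 - j) with hP
    set Q := f (1 / 2 + j) with hQ
    have hp : 12 * (x - 1 / 2) ^ 2 - r ^ 2 = 12 * ((x - 1 / 2 - j) * (x - 1 / 2 + j)) := by
      nlinarith
    rw [hp]
    have hl : (P + Q) / 2 + (Q - P) / (2 * j) * (x - 1 / 2) =
        ((1 / 2 + j - x) * P + (x - (1 / 2 - j)) * Q) / (2 * j) := by
      field_simp
      ring
    rw [hl]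
    rcases le_or_gt x (1 / 2 - j) with h1 | h1
    · have h := hf.three_point hx01 hmem2 h1 (by linarith : 1 / 2 - j ≤ 1 / 2 + j)
      rw [← hP, ← hQ] at h
      have h' : f x ≤ ((1 / 2 + j - x) * P + (x - (1 / 2 - j)) * Q) / (2 * j) := by
        rw [le_div_iff₀ (by linarith)]
        linarith
      apply mul_le_mul_of_nonneg_right h'
      have := mul_nonneg_of_nonpos_of_nonpos (a := x - 1 / 2 - j) (b := x - 1 / 2 + j)
        (by linarith) (by linarith)
      linarith
    rcases le_or_gt x (1 / 2 + j) with h2 | h2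
    · have h := hf.three_point hmem1 hmem2 h1.le h2
      rw [← hP, ← hQ] at h
      have h' : ((1 / 2 + j - x) * P + (x - (1 / 2 - j)) * Q) / (2 * j) ≤ f x := by
        rw [div_le_iff₀ (by linarith)]
        linarith
      apply mul_le_mul_of_nonpos_right h'
      have := mul_nonpos_of_nonpos_of_nonneg (a := x - 1 / 2 - j) (b := x - 1 / 2 + j)
        (by linarith) (by linarith)
      linarith
    · have h := hf.three_point hmem1 hx01 (by linarith : 1 / 2 - j ≤ 1 / 2 + j) h2.le
      rw [← hP, ← hQ] at h
      have h' : f x ≤ ((1 / 2 + j - x) * P + (x - (1 / 2 - j)) * Q) / (2 * j) := by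
        rw [le_div_iff₀ (by linarith)]
        linarith
      apply mul_le_mul_of_nonneg_right h'
      have := mul_nonneg (a := x - 1 / 2 - j) (b := x - 1 / 2 + j)
        (by linarith) (by linarith)
      linarith
  obtain ⟨A, B, hAB⟩ := chord
  have hii : ∀ (a b : ℝ) (p : ℝ → ℝ), Continuous p → 0 ≤ a → a ≤ b → b ≤ 1 →
      IntervalIntegrable (fun x => f x * p x) volume a b := by
    intro a b p hp h0 hab h1
    refine (hfi.mul_continuousOn hp.continuousOn).mono_set ?_
    rw [uIcc_of_le hab, uIcc_of_le zero_le_one]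
    exact Icc_subset_Icc h0 h1
  set p : ℝ → ℝ := fun x => 12 * (x - 1 / 2) ^ 2 - r ^ 2 with hp
  have hpc : Continuous p := by fun_prop
  have i1 := hii 0 z p hpc le_rfl hz0.le (by linarith)
  have i2 := hii z (1 - z) p hpc hz0.le (by linarith) (by linarith)
  have i3 := hii (1 - z) 1 p hpc (by linarith) (by linarith) le_rfl
  have hsum := intervalIntegral.integral_add_adjacent_intervals (i1.trans i2) i3
  rw [← intervalIntegral.integral_add_adjacent_intervals i1 i2] at hsum
  have e1 : ∫ x in (0 : ℝ)..z, f x * p x ≤ m * (k ^ 2) ^ 2 := by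
    have : ∫ x in (0 : ℝ)..z, (0 + m * (3 - r ^ 2) * x + (-12 * m) * x ^ 2 +
        (12 * m) * x ^ 3) = m * (k ^ 2) ^ 2 := by
      rw [integral_cubic, ← hzk, hrz]
      ring
    rw [← this]
    refine intervalIntegral.integral_mono_on hz0.le i1
      (Continuous.intervalIntegrable (by fun_prop) _ _) fun x hx => ?_
    have hpx : 0 ≤ p x := by simp only [hp]; nlinarith [hx.1, hx.2]
    have := mul_le_mul_of_nonneg_right (hm x ⟨hx.1, by linarith [hx.2]⟩) hpx
    refine this.trans_eq ?_
    simp only [hp]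
    ring
  have e3 : ∫ x in (1 - z)..1, f x * p x ≤ n * (k ^ 2) ^ 2 := by
    have : ∫ x in (1 - z)..1, (n * (3 - r ^ 2) + n * (r ^ 2 - 15) * x + (24 * n) * x ^ 2 +
        (-12 * n) * x ^ 3) = n * (k ^ 2) ^ 2 := by
      rw [integral_cubic, ← hzk, hrz]
      ring
    rw [← this]
    refine intervalIntegral.integral_mono_on (by linarith) i3
      (Continuous.intervalIntegrable (by fun_prop) _ _) fun x hx => ?_
    have hpx : 0 ≤ p x := by simp only [hp]; nlinarith [hx.1, hx.2]
    have := mul_le_mul_of_nonneg_right (hn x ⟨by linarith [hx.1], hx.2⟩) hpx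
    refine this.trans_eq ?_
    simp only [hp]
    ring
  have e2 : ∫ x in z..(1 - z), f x * p x ≤ 0 := by
    have : ∫ x in z..(1 - z), ((A - B / 2) * (3 - r ^ 2) +
        ((A - B / 2) * (-12) + B * (3 - r ^ 2)) * x + ((A - B / 2) * 12 - 12 * B) * x ^ 2 +
        (12 * B) * x ^ 3) = 0 := by
      rw [integral_cubic, hrz]
      ring
    rw [← this]
    refine intervalIntegral.integral_mono_on (by linarith) i2
      (Continuous.intervalIntegrable (by fun_prop) _ _) fun x hx => ?_
    refine (hAB x hx).trans_eq ?_
    ring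
  have e4 : ∫ x in (0 : ℝ)..1, f x * (12 * x * (1 - x)) =
      (3 - r ^ 2) * (k / 2) - ∫ x in (0 : ℝ)..1, f x * p x := by
    rw [← hI, ← intervalIntegral.integral_const_mul, ← intervalIntegral.integral_sub
      (hfi.const_mul _) (hii 0 1 p hpc le_rfl zero_le_one le_rfl)]
    congr 1
    funext x
    simp only [hp]
    ring
  rw [e4, hr2]
  have h5 : (m + n) * (k ^ 2) ^ 2 ≤ k ^ 3 := by
    have := mul_le_mul_of_nonneg_right hmn (pow_pos hk 3).le
    nlinarith
  nlinarith

theorem first_moments_le {μ : ℝ → ℝ} {k : ℝ} (hk : 0 < k)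
    (hμ : IntervalIntegrable μ volume 0 k)
    (hstar : ∀ v w, 0 ≤ v → v < w → w < k → 1 - w / k ≤ μ w → 1 - v / k ≤ μ v)
    (hI : ∫ w in (0 : ℝ)..k, μ w = k / 2) :
    ∫ w in (0 : ℝ)..k, (w + w ^ 2) * μ w ≤ k ^ 2 / 6 + k ^ 3 / 12 := by
  set D : Set ℝ := insert 0 {w | 0 ≤ w ∧ w < k ∧ 1 - w / k ≤ μ w} with hD
  have hbdd : BddAbove D := ⟨k, by
    rintro w (rfl | hw)
    · exact hk.le
    · exact hw.2.1.le⟩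
  set w₀ := sSup D with hw₀
  have hw₀0 : 0 ≤ w₀ := le_csSup hbdd (mem_insert _ _)
  have hpt : ∀ w ∈ Ioo 0 k, (w + w ^ 2) * μ w ≤
      (w + w ^ 2) * (1 - w / k) + (w₀ + w₀ ^ 2) * (μ w - (1 - w / k)) := by
    intro w hw
    rcases lt_trichotomy w w₀ with h | h | h
    · obtain ⟨d, hdD, hd⟩ := exists_lt_of_lt_csSup ⟨0, mem_insert _ _⟩ h
      have hμw : 1 - w / k ≤ μ w := by
        rcases hdD with rfl | hdD
        · exact absurd hd (not_lt.2 hw.1.le)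
        · exact hstar w d hw.1.le hd hdD.2.1 hdD.2.2
      have : w + w ^ 2 ≤ w₀ + w₀ ^ 2 := by nlinarith [hw.1]
      nlinarith [mul_nonneg (sub_nonneg.2 this) (sub_nonneg.2 hμw)]
    · rw [← h]
      apply le_of_eq
      ring
    · have hμw : μ w ≤ 1 - w / k := by
        by_contra! hc
        exact absurd (le_csSup hbdd (mem_insert_of_mem _ ⟨hw.1.le, hw.2, hc.le⟩)) (not_le.2 h)
      have : w₀ + w₀ ^ 2 ≤ w + w ^ 2 := by nlinarith [hw.1]
      nlinarith [mul_nonneg (sub_nonneg.2 this) (sub_nonneg.2 hμw)]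
  have c1 : Continuous fun w : ℝ => 1 - w / k := by fun_prop
  have c2 : Continuous fun w : ℝ => (w + w ^ 2) * (1 - w / k) := by fun_prop
  have ii : IntervalIntegrable (fun w => (w₀ + w₀ ^ 2) * (μ w - (1 - w / k))) volume 0 k :=
    (hμ.sub (c1.intervalIntegrable _ _)).const_mul _
  have h := intervalIntegral.integral_mono_on_of_le_Ioo hk.le
    (hμ.continuousOn_mul (Continuous.continuousOn (by fun_prop : Continuous fun w : ℝ => w + w ^ 2)))
    ((c2.intervalIntegrable 0 k).add ii) hpt
  rw [intervalIntegral.integral_add (c2.intervalIntegrable _ _) ii,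
    intervalIntegral.integral_const_mul,
    intervalIntegral.integral_sub hμ (c1.intervalIntegrable _ _), hI] at h
  have j1 : ∫ w in (0 : ℝ)..k, (1 - w / k) = k / 2 := by
    have := integral_cubic 0 k 1 (-1 / k) 0 0
    rw [show (fun w : ℝ => 1 - w / k) = fun w => 1 + (-1 / k) * w + 0 * w ^ 2 + 0 * w ^ 3 by
      funext w; ring, this]
    field_simp
    ring
  have j2 : ∫ w in (0 : ℝ)..k, (w + w ^ 2) * (1 - w / k) = k ^ 2 / 6 + k ^ 3 / 12 := by
    have := integral_cubic 0 k 0 1 (1 - 1 / k) (-1 / k)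
    rw [show (fun w : ℝ => (w + w ^ 2) * (1 - w / k)) =
      fun w => 0 + 1 * w + (1 - 1 / k) * w ^ 2 + (-1 / k) * w ^ 3 by funext w; ring, this]
    field_simp
    ring
  rw [j1, j2] at h
  linarith


theorem integrable_section {R : Set (ℝ × ℝ)} (hR : IsCompact R) {F : ℝ × ℝ → ℝ}
    (hF : Continuous F) : Integrable fun x : ℝ => ∫ y in {y | (x, y) ∈ R}, F (x, y) := by
  have hi : Integrable (R.indicator F) (volume.prod volume) :=
    (integrable_indicator_iff hR.measurableSet).2 (hF.continuousOn.integrableOn_compact hR)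
  refine hi.integral_prod_left.congr (Filter.Eventually.of_forall fun x => ?_)
  have hm : MeasurableSet {y | (x, y) ∈ R} := measurable_prodMk_left hR.measurableSet
  change ∫ y, R.indicator F (x, y) = ∫ y in {y | (x, y) ∈ R}, F (x, y)
  rw [← integral_indicator hm]
  rfl

theorem isCompact_section {R : Set (ℝ × ℝ)} (hR : IsCompact R) (x : ℝ) :
    IsCompact {y | (x, y) ∈ R} := by
  have h : {y | (x, y) ∈ R} = Prod.snd '' (R ∩ {q | q.1 = x}) := by
    ext y
    constructor
    · intro hy
      exact ⟨(x, y), ⟨hy, rfl⟩, rfl⟩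
    · rintro ⟨⟨a, b⟩, ⟨hq, rfl⟩, rfl⟩
      exact hq
  rw [h]
  exact (hR.inter_right (isClosed_eq continuous_fst continuous_const)).image continuous_snd

theorem isCompact_section_symm {R : Set (ℝ × ℝ)} (hR : IsCompact R) (y : ℝ) :
    IsCompact {x | (x, y) ∈ R} := by
  have h : {x | (x, y) ∈ R} = Prod.fst '' (R ∩ {q | q.2 = y}) := by
    ext x
    constructor
    · intro hy
      exact ⟨(x, y), ⟨hy, rfl⟩, rfl⟩
    · rintro ⟨⟨a, b⟩, ⟨hq, rfl⟩, rfl⟩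
      exact hq
  rw [h]
  exact (hR.inter_right (isClosed_eq continuous_snd continuous_const)).image continuous_fst

/-- A convex set over the segment from `(0, 0)` to `(1, 0)` is the subgraph of a concave
function. -/
theorem exists_concave_height {R : Set (ℝ × ℝ)} (hR : IsCompact R) (hc : Convex ℝ R)
    (h0 : ((0 : ℝ), (0 : ℝ)) ∈ R) (h1 : ((1 : ℝ), (0 : ℝ)) ∈ R)
    (hsub : ∀ x y, (x, y) ∈ R → x ∈ Icc (0 : ℝ) 1 ∧ 0 ≤ y) :
    ∃ f : ℝ → ℝ, ConcaveOn ℝ (Icc 0 1) f ∧ (∀ x ∈ Icc (0 : ℝ) 1, 0 ≤ f x) ∧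
      ∀ x y, (x, y) ∈ R ↔ x ∈ Icc (0 : ℝ) 1 ∧ y ∈ Icc 0 (f x) := by
  have hb : ∀ x ∈ Icc (0 : ℝ) 1, (x, (0 : ℝ)) ∈ R := by
    rintro x ⟨hx0, hx1⟩
    have := hc h0 h1 (sub_nonneg.2 hx1) hx0 (by ring)
    simpa using this
  have htop : ∀ x ∈ Icc (0 : ℝ) 1, (x, sSup {y | (x, y) ∈ R}) ∈ R := fun x hx =>
    (isCompact_section hR x).sSup_mem ⟨0, hb x hx⟩
  have hle : ∀ x y, (x, y) ∈ R → y ≤ sSup {y | (x, y) ∈ R} := fun x y h =>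
    le_csSup (isCompact_section hR x).bddAbove h
  refine ⟨fun x => sSup {y | (x, y) ∈ R}, ⟨convex_Icc 0 1, ?_⟩, fun x hx => hle x 0 (hb x hx),
    fun x y => ⟨fun h => ⟨(hsub x y h).1, (hsub x y h).2, hle x y h⟩, ?_⟩⟩
  · intro x hx y hy a b ha hb' hab
    apply hle
    have := hc (htop x hx) (htop y hy) ha hb' hab
    simpa using this
  · rintro ⟨hx, hy0, hy⟩
    rcases hy0.eq_or_lt with rfl | hy0'
    · exact hb x hx
    have hp : 0 < sSup {y | (x, y) ∈ R} := hy0'.trans_le hy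
    have := hc (hb x hx) (htop x hx) (a := 1 - y / sSup {y | (x, y) ∈ R})
      (b := y / sSup {y | (x, y) ∈ R}) (sub_nonneg.2 ((div_le_one hp).2 hy))
      (div_nonneg hy0 hp.le) (by ring)
    have he : (1 - y / sSup {y | (x, y) ∈ R}) • (x, (0 : ℝ)) +
        (y / sSup {y | (x, y) ∈ R}) • (x, sSup {y | (x, y) ∈ R}) = (x, y) := by
      ext
      · simp; ring
      · simp [hp.ne']
    rwa [he] at this

theorem section_length_star {R : Set (ℝ × ℝ)} (hR : IsCompact R) (hc : Convex ℝ R)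
    (h0 : ((0 : ℝ), (0 : ℝ)) ∈ R) (h1 : ((1 : ℝ), (0 : ℝ)) ∈ R) {v w x : ℝ} (hv : 0 ≤ v)
    (hvw : v ≤ w) (hw : 0 < w) (hx : (x, w) ∈ R) :
    1 - v / w + v / w * volume.real {x | (x, w) ∈ R} ≤ volume.real {x | (x, v) ∈ R} := by
  have hS := isCompact_section_symm hR w
  set α := sInf {x | (x, w) ∈ R} with hα
  set β := sSup {x | (x, w) ∈ R} with hβ
  have hαm : (α, w) ∈ R := hS.sInf_mem ⟨x, hx⟩
  have hβm : (β, w) ∈ R := hS.sSup_mem ⟨x, hx⟩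
  have hαβ : α ≤ β := csInf_le hS.bddBelow hβm
  have hup : volume.real {x | (x, w) ∈ R} ≤ β - α := by
    rw [← Real.volume_real_Icc_of_le hαβ]
    exact measureReal_mono (fun y hy => ⟨csInf_le hS.bddBelow hy, le_csSup hS.bddAbove hy⟩)
      isCompact_Icc.measure_lt_top.ne
  have ht0 : 0 ≤ v / w := div_nonneg hv hw.le
  have ht1 : v / w ≤ 1 := (div_le_one hw).2 hvw
  have hvw' : v / w * w = v := div_mul_cancel₀ _ hw.ne'
  set t := v / w
  have hl : (t * α, v) ∈ R := by
    have := hc h0 hαm (sub_nonneg.2 ht1) ht0 (by ring)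
    simpa [hvw'] using this
  have hr : (1 - t + t * β, v) ∈ R := by
    have := hc h1 hβm (sub_nonneg.2 ht1) ht0 (by ring)
    simpa [hvw'] using this
  have hlr : t * α ≤ 1 - t + t * β := by nlinarith
  have hsub : Icc (t * α) (1 - t + t * β) ⊆ {x | (x, v) ∈ R} := by
    have hcv : Convex ℝ {x | (x, v) ∈ R} := by
      intro a ha b hb p q hp hq hpq
      have := hc ha hb hp hq hpq
      simpa [← add_mul, hpq] using this
    rw [← segment_eq_Icc hlr]
    exact hcv.segment_subset hl hr
  have hlow : 1 - t + t * β - t * α ≤ volume.real {x | (x, v) ∈ R} := by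
    rw [← Real.volume_real_Icc_of_le hlr]
    exact measureReal_mono hsub (isCompact_section_symm hR v).measure_lt_top.ne
  nlinarith

theorem section_length_eq (S : Set ℝ) : ∫ _ in S, (1 : ℝ) = volume.real S := by
  simp

theorem cap_height_le {R : Set (ℝ × ℝ)} (hR : IsCompact R) (hc : Convex ℝ R)
    (h0 : ((0 : ℝ), (0 : ℝ)) ∈ R) (h1 : ((1 : ℝ), (0 : ℝ)) ∈ R) {w x : ℝ} (hw : 0 < w)
    (hx : (x, w) ∈ R) : w ≤ 2 * ∫ _ in R, (1 : ℝ) := by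
  have hint := integrable_section_symm hR (F := fun _ => 1) continuous_const
  rw [setIntegral_eq_integral_section_symm hR continuous_const]
  simp only [section_length_eq] at hint ⊢
  have h2 : ∫ v in (0 : ℝ)..w, volume.real {x | (x, v) ∈ R} ≤
      ∫ v, volume.real {x | (x, v) ∈ R} := by
    rw [intervalIntegral.integral_of_le hw.le]
    exact setIntegral_le_integral hint (Filter.Eventually.of_forall fun v => measureReal_nonneg)
  have h3 : ∫ v in (0 : ℝ)..w, (1 - v / w) ≤ ∫ v in (0 : ℝ)..w, volume.real {x | (x, v) ∈ R} := by
    refine intervalIntegral.integral_mono_on hw.le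
      (Continuous.intervalIntegrable (by fun_prop) _ _) hint.intervalIntegrable fun v hv => ?_
    refine le_trans ?_ (section_length_star hR hc h0 h1 hv.1 hv.2 hw hx)
    exact le_add_of_nonneg_right (mul_nonneg (div_nonneg hv.1 hw.le) measureReal_nonneg)
  have h4 : ∫ v in (0 : ℝ)..w, (1 - v / w) = w / 2 := by
    have := integral_cubic 0 w 1 (-1 / w) 0 0
    rw [show (fun v => 1 - v / w) = fun x => 1 + -1 / w * x + 0 * x ^ 2 + 0 * x ^ 3 by
      funext v; ring, this]
    field_simp
    ring
  linarith

theorem cap_height_moments_le {R : Set (ℝ × ℝ)} (hR : IsCompact R) (hc : Convex ℝ R)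
    (h0 : ((0 : ℝ), (0 : ℝ)) ∈ R) (h1 : ((1 : ℝ), (0 : ℝ)) ∈ R)
    (hsub : ∀ x y, (x, y) ∈ R → 0 ≤ y) {k : ℝ} (hk : 0 < k)
    (hI : ∫ _ in R, (1 : ℝ) = k / 2) :
    ∫ q in R, (q.2 + q.2 ^ 2) ≤ k ^ 2 / 6 + k ^ 3 / 12 := by
  have hint := integrable_section_symm hR (F := fun _ => 1) continuous_const
  simp only [section_length_eq] at hint
  have hemp : ∀ v, v ∉ Icc 0 k → {x | (x, v) ∈ R} = ∅ := by
    intro v hv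
    ext x
    refine iff_of_false (fun h => hv ⟨hsub x v h, ?_⟩) (fun h => h)
    rcases (hsub x v h).eq_or_lt with rfl | h'
    · exact hk.le
    · have := cap_height_le hR hc h0 h1 h' h
      linarith
  have hrest : ∀ g : ℝ → ℝ, (∀ v, v ∉ Icc 0 k → g v = 0) → ∫ v, g v = ∫ v in (0 : ℝ)..k, g v := by
    intro g hg
    rw [intervalIntegral.integral_of_le hk.le, ← integral_Icc_eq_integral_Ioc,
      setIntegral_eq_integral_of_forall_compl_eq_zero hg]
  rw [setIntegral_eq_integral_section_symm hR continuous_const] at hI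
  simp only [section_length_eq] at hI
  rw [hrest _ fun v hv => by rw [hemp v hv]; simp] at hI
  rw [setIntegral_eq_integral_section_symm hR (by fun_prop)]
  have he : ∀ v : ℝ, ∫ _ in {x | (x, v) ∈ R}, (v + v ^ 2) =
      (v + v ^ 2) * volume.real {x | (x, v) ∈ R} := by
    intro v
    simp [mul_comm]
  simp only [he]
  rw [hrest _ fun v hv => by rw [hemp v hv]; simp]
  refine first_moments_le hk hint.intervalIntegrable ?_ hI
  intro v w hv hvw hwk hw
  have hw0 : 0 < w := hv.trans_lt hvw
  have hne : {x | (x, w) ∈ R}.Nonempty := by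
    by_contra hne
    rw [not_nonempty_iff_eq_empty] at hne
    rw [hne] at hw
    have : w / k < 1 := (div_lt_one hk).2 hwk
    simp at hw
    linarith
  obtain ⟨x, hx⟩ := hne
  refine le_trans ?_ (section_length_star hR hc h0 h1 hv hvw.le hw0 hx)
  have h5 := mul_le_mul_of_nonneg_left hw (div_nonneg hv hw0.le)
  have h6 : v / w * (1 - w / k) = v / w - v / k := by field_simp
  linarith

/-- A cap under two lines of slopes `m` and `-n` through the end points of its base has at most
the area of the triangle they cut out. -/
theorem cap_area_le {f : ℝ → ℝ} (hfi : IntervalIntegrable f volume 0 1) {m n : ℝ}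
    (hm0 : 0 < m) (hn0 : 0 < n)
    (hm : ∀ x ∈ Icc (0 : ℝ) 1, f x ≤ m * x) (hn : ∀ x ∈ Icc (0 : ℝ) 1, f x ≤ n * (1 - x)) :
    2 * ∫ x in (0 : ℝ)..1, f x ≤ m * n / (m + n) := by
  have hp0 : 0 ≤ n / (m + n) := by positivity
  have hp1 : n / (m + n) ≤ 1 := (div_le_one (by positivity)).2 (by linarith)
  have hp : n / (m + n) * (m + n) = n := div_mul_cancel₀ _ (by positivity)
  have hmp : m * n / (m + n) = m * (n / (m + n)) := by ring
  rw [hmp]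
  set p := n / (m + n)
  have hi1 : IntervalIntegrable f volume 0 p := hfi.mono_set (by
    rw [uIcc_of_le hp0, uIcc_of_le zero_le_one]; exact Icc_subset_Icc le_rfl hp1)
  have hi2 : IntervalIntegrable f volume p 1 := hfi.mono_set (by
    rw [uIcc_of_le hp1, uIcc_of_le zero_le_one]; exact Icc_subset_Icc hp0 le_rfl)
  have e1 := intervalIntegral.integral_mono_on hp0 hi1
    (g := fun x => 0 + m * x + 0 * x ^ 2 + 0 * x ^ 3)
    (Continuous.intervalIntegrable (by fun_prop) _ _)
    (fun x hx => by have := hm x ⟨hx.1, hx.2.trans hp1⟩; linarith)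
  have e2 := intervalIntegral.integral_mono_on hp1 hi2
    (g := fun x => n + -n * x + 0 * x ^ 2 + 0 * x ^ 3)
    (Continuous.intervalIntegrable (by fun_prop) _ _)
    (fun x hx => by have := hn x ⟨hp0.trans hx.1, hx.2⟩; linarith)
  rw [integral_cubic] at e1 e2
  rw [← intervalIntegral.integral_add_adjacent_intervals hi1 hi2]
  have hn' : n = p * (m + n) := hp.symm
  have hq : n * (1 - p) = m * p := by linarith
  nlinarith

theorem cap_bounds {R : Set (ℝ × ℝ)} (hR : IsCompact R) (hc : Convex ℝ R)
    (h0 : ((0 : ℝ), (0 : ℝ)) ∈ R) (h1 : ((1 : ℝ), (0 : ℝ)) ∈ R) {m n k : ℝ} (hm0 : 0 < m)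
    (hn0 : 0 < n) (hsub : ∀ x y, (x, y) ∈ R → 0 ≤ y ∧ y ≤ m * x ∧ y ≤ n * (1 - x))
    (hI : ∫ _ in R, (1 : ℝ) = k / 2) :
    k * (m + n) ≤ m * n ∧ (0 < k → k * (m + n) ≤ 1 →
      ∫ q in R, (1 - 2 * q.1 * (1 - q.1) + 2 * q.2 + 2 * q.2 ^ 2) ≤ k / 3 + k ^ 2 / 3) := by
  obtain ⟨f, hf, hf0, hfR⟩ := exists_concave_height hR hc h0 h1 fun x y hxy => by
    obtain ⟨h1, h2, h3⟩ := hsub x y hxy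
    exact ⟨⟨nonneg_of_mul_nonneg_right (h1.trans h2) hm0,
      sub_nonneg.1 (nonneg_of_mul_nonneg_right (h1.trans h3) hn0)⟩, h1⟩
  have hftop : ∀ x ∈ Icc (0 : ℝ) 1, (x, f x) ∈ R := fun x hx =>
    (hfR x (f x)).2 ⟨hx, hf0 x hx, le_rfl⟩
  have hfm : ∀ x ∈ Icc (0 : ℝ) 1, f x ≤ m * x := fun x hx => (hsub _ _ (hftop x hx)).2.1
  have hfn : ∀ x ∈ Icc (0 : ℝ) 1, f x ≤ n * (1 - x) := fun x hx => (hsub _ _ (hftop x hx)).2.2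
  have hfi : IntervalIntegrable f volume 0 1 := by
    have h := (integrable_section hR (F := fun _ => 1) continuous_const).intervalIntegrable
      (a := 0) (b := 1)
    refine h.congr fun x hx => ?_
    rw [uIoc_of_le zero_le_one] at hx
    have hx' : x ∈ Icc (0 : ℝ) 1 := ⟨hx.1.le, hx.2⟩
    have : {y | (x, y) ∈ R} = Icc 0 (f x) := by
      ext y
      exact (hfR x y).trans (and_iff_right hx')
    simp only [section_length_eq, this]
    rw [Real.volume_real_Icc_of_le (hf0 x hx'), sub_zero]
  have harea : ∫ x in (0 : ℝ)..1, f x = k / 2 := by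
    rw [← hI, setIntegral_of_section_Icc hR hf0 hfR continuous_const]
    simp
  have hle := cap_area_le hfi hm0 hn0 hfm hfn
  rw [harea, le_div_iff₀ (by positivity)] at hle
  have hle' : k * (m + n) ≤ m * n := by linarith
  refine ⟨hle', fun hk hmn => ?_⟩
  have hk2 : k ≤ 1 / 2 := by
    have h4 : 4 * (m * n) ≤ (m + n) ^ 2 := by nlinarith [sq_nonneg (m - n)]
    have h5 : 4 * k ≤ m + n := by
      by_contra! h
      nlinarith
    nlinarith
  have hmom := concave_moment_ge hf hfi hfm hfn hk hk2 hmn harea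
  have hhei := cap_height_moments_le hR hc h0 h1 (fun x y h => (hsub x y h).1) hk hI
  have hc1 : Continuous fun q : ℝ × ℝ => 12 * q.1 * (1 - q.1) := by fun_prop
  have hmom' : ∫ q in R, 12 * q.1 * (1 - q.1) = ∫ x in (0 : ℝ)..1, f x * (12 * x * (1 - x)) := by
    rw [setIntegral_of_section_Icc hR hf0 hfR hc1]
    simp only [intervalIntegral.integral_const, sub_zero, smul_eq_mul]
  rw [← hmom'] at hmom
  have hint : ∀ {F : ℝ × ℝ → ℝ}, Continuous F → IntegrableOn F R := fun hF =>
    hF.continuousOn.integrableOn_compact hR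
  have hsplit : ∫ q in R, (1 - 2 * q.1 * (1 - q.1) + 2 * q.2 + 2 * q.2 ^ 2) =
      (∫ _ in R, (1 : ℝ)) - (1 / 6) * (∫ q in R, 12 * q.1 * (1 - q.1)) +
        2 * ∫ q in R, (q.2 + q.2 ^ 2) := by
    rw [← integral_const_mul, ← integral_const_mul, ← integral_sub (hint continuous_const)
      (hint (by fun_prop)), ← integral_add (hint (by fun_prop)) (hint (by fun_prop))]
    congr 1
    funext q
    ring
  rw [hsplit, hI]
  linarith

/-- The part of `Q` beyond the line `x + y = 1`, in coordinates along and across that line. -/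
def cornerCap (Q : Set (ℝ × ℝ)) : Set (ℝ × ℝ) :=
  {p | 0 ≤ p.2 ∧ (1 - p.1 + p.2, p.1 + p.2) ∈ Q}

theorem mem_cornerCap {Q : Set (ℝ × ℝ)} {x y : ℝ} :
    (x, y) ∈ cornerCap Q ↔ 0 ≤ y ∧ (1 - x + y, x + y) ∈ Q := Iff.rfl

theorem isCompact_cornerCap {Q : Set (ℝ × ℝ)} (hQ : IsCompact Q) : IsCompact (cornerCap Q) := by
  have h : cornerCap Q =
      (fun q : ℝ × ℝ => ((q.2 - q.1 + 1) / 2, (q.1 + q.2 - 1) / 2)) ''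
        (Q ∩ {q | 1 ≤ q.1 + q.2}) := by
    ext ⟨x, y⟩
    rw [mem_cornerCap]
    constructor
    · rintro ⟨hy, hq⟩
      refine ⟨_, ⟨hq, ?_⟩, ?_⟩
      · change 1 ≤ 1 - x + y + (x + y)
        linarith
      · ext <;> simp <;> ring
    · rintro ⟨⟨a, b⟩, ⟨hq, h1⟩, he⟩
      have h1' : 1 ≤ a + b := h1
      obtain ⟨rfl, rfl⟩ := Prod.mk.inj he
      refine ⟨by simp only; linarith, ?_⟩
      convert hq using 2 <;> simp only <;> ring
  rw [h]
  refine (hQ.inter_right (isClosed_le continuous_const (by fun_prop))).image (by fun_prop)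

theorem convex_cornerCap {Q : Set (ℝ × ℝ)} (hQ : Convex ℝ Q) : Convex ℝ (cornerCap Q) := by
  rintro ⟨x, y⟩ hx ⟨x', y'⟩ hy a b ha hb hab
  rw [mem_cornerCap] at hx hy
  have hm := hQ hx.2 hy.2 ha hb hab
  change (a * x + b * x', a * y + b * y') ∈ _
  refine mem_cornerCap.2 ⟨add_nonneg (mul_nonneg ha hx.1) (mul_nonneg hb hy.1), ?_⟩
  convert hm using 1
  ext
  · simp
    linear_combination -hab
  · simp
    ring

theorem setIntegral_corner {Q : Set (ℝ × ℝ)} (hQ : IsCompact Q) (hc : Convex ℝ Q)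
    (hpos : ∀ x y, (x, y) ∈ Q → 0 ≤ x ∧ 0 ≤ y) (h0 : ((0 : ℝ), (0 : ℝ)) ∈ Q)
    (h1 : ((1 : ℝ), (0 : ℝ)) ∈ Q) (h2 : ((0 : ℝ), (1 : ℝ)) ∈ Q) {F : ℝ × ℝ → ℝ}
    (hF : Continuous F) :
    ∫ q in Q, F q = (∫ x in (0 : ℝ)..1, ∫ y in (0 : ℝ)..(1 - x), F (x, y)) +
      2 * ∫ p in cornerCap Q, F (1 - p.1 + p.2, p.1 + p.2) := by
  rw [setIntegral_eq_add_of_line hQ hF (a := 1) (b := 1) 1 (by norm_num), add_comm]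
  congr 1
  · refine setIntegral_of_section_Icc
      (hQ.inter_right (isClosed_le (by fun_prop) continuous_const)) (f := fun x => 1 - x)
      (fun x hx => by linarith [hx.2]) (fun x y => ⟨?_, ?_⟩) hF
    · rintro ⟨hq, hxy⟩
      have hxy' : 1 * x + 1 * y ≤ 1 := hxy
      obtain ⟨hx, hy⟩ := hpos x y hq
      exact ⟨⟨hx, by linarith⟩, hy, by linarith⟩
    · rintro ⟨⟨hx, -⟩, hy, hxy⟩
      refine ⟨?_, ?_⟩
      · have hxy' : y ≤ 1 - x := hxy
        have := hc.sum_mem (t := Finset.univ) (w := ![1 - x - y, x, y])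
          (z := ![((0 : ℝ), (0 : ℝ)), (1, 0), (0, 1)])
          (by intro i _; fin_cases i <;> simp <;> linarith)
          (by simp [Fin.sum_univ_three]; ring)
          (by intro i _; fin_cases i <;> simpa)
        simpa [Fin.sum_univ_three] using this
      · change 1 * x + 1 * y ≤ 1
        have hxy' : y ≤ 1 - x := hxy
        linarith
  · rw [setIntegral_linear_change (a := -1) (b := 1) (c := 1) (d := 1) (by norm_num) _ F 1 0]
    have he : ∀ q : ℝ × ℝ, ((-1 * q.1 + 1 * q.2 + 1, 1 * q.1 + 1 * q.2 + 0) : ℝ × ℝ) =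
        (1 - q.1 + q.2, q.1 + q.2) := by
      intro q
      ext <;> simp only <;> ring
    simp only [he]
    have hs : (fun q : ℝ × ℝ => (1 - q.1 + q.2, q.1 + q.2)) ⁻¹'
        (Q ∩ {q | 1 ≤ 1 * q.1 + 1 * q.2}) = cornerCap Q := by
      ext ⟨x, y⟩
      rw [mem_cornerCap]
      constructor
      · rintro ⟨hq, hxy⟩
        have hxy' : 1 ≤ 1 * (1 - x + y) + 1 * (x + y) := hxy
        exact ⟨by linarith, hq⟩
      · rintro ⟨hy, hq⟩
        refine ⟨hq, ?_⟩
        change 1 ≤ 1 * (1 - x + y) + 1 * (x + y)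
        linarith
    rw [hs]
    norm_num

theorem corner_area {Q : Set (ℝ × ℝ)} (hQ : IsCompact Q) (hc : Convex ℝ Q)
    (hpos : ∀ x y, (x, y) ∈ Q → 0 ≤ x ∧ 0 ≤ y) (h0 : ((0 : ℝ), (0 : ℝ)) ∈ Q)
    (h1 : ((1 : ℝ), (0 : ℝ)) ∈ Q) (h2 : ((0 : ℝ), (1 : ℝ)) ∈ Q) :
    ∫ _ in Q, (1 : ℝ) = 1 / 2 + 2 * ∫ _ in cornerCap Q, (1 : ℝ) := by
  rw [setIntegral_corner hQ hc hpos h0 h1 h2 continuous_const]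
  congr 1
  have := integral_cubic 0 1 1 (-1) 0 0
  rw [show (fun x : ℝ => ∫ _ in (0 : ℝ)..(1 - x), (1 : ℝ)) =
    fun x => 1 + -1 * x + 0 * x ^ 2 + 0 * x ^ 3 by funext x; simp; ring, this]
  norm_num

theorem corner_second_moment {Q : Set (ℝ × ℝ)} (hQ : IsCompact Q) (hc : Convex ℝ Q)
    (hpos : ∀ x y, (x, y) ∈ Q → 0 ≤ x ∧ 0 ≤ y) (h0 : ((0 : ℝ), (0 : ℝ)) ∈ Q)
    (h1 : ((1 : ℝ), (0 : ℝ)) ∈ Q) (h2 : ((0 : ℝ), (1 : ℝ)) ∈ Q) :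
    ∫ q in Q, (q.1 ^ 2 + q.2 ^ 2) = 1 / 6 +
      2 * ∫ p in cornerCap Q, (1 - 2 * p.1 * (1 - p.1) + 2 * p.2 + 2 * p.2 ^ 2) := by
  rw [setIntegral_corner hQ hc hpos h0 h1 h2 (by fun_prop)]
  congr 1
  · have hin : ∀ x : ℝ, ∫ y in (0 : ℝ)..(1 - x), (x ^ 2 + y ^ 2) =
        1 / 3 + -1 * x + 2 * x ^ 2 + (-4 / 3) * x ^ 3 := by
      intro x
      have := integral_cubic 0 (1 - x) (x ^ 2) 0 1 0
      rw [show (fun y : ℝ => x ^ 2 + y ^ 2) =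
        fun y => x ^ 2 + 0 * y + 1 * y ^ 2 + 0 * y ^ 3 by funext y; ring, this]
      ring
    simp only [hin]
    rw [integral_cubic]
    norm_num
  · congr 2
    funext p
    ring

theorem corner_slopes {Q : Set (ℝ × ℝ)} {ε δ : ℝ} (hε : -1 < ε ∧ ε < 1) (hδ : -1 < δ ∧ δ < 1)
    (hsub : ∀ x y, (x, y) ∈ Q → x ≤ 1 + ε * y ∧ y ≤ 1 + δ * x) (x y : ℝ)
    (h : (x, y) ∈ cornerCap Q) :
    0 ≤ y ∧ y ≤ (1 + ε) / (1 - ε) * x ∧ y ≤ (1 + δ) / (1 - δ) * (1 - x) := by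
  obtain ⟨hy, hq⟩ := h
  obtain ⟨ha, hb⟩ := hsub _ _ hq
  simp only at ha hb
  refine ⟨hy, ?_, ?_⟩
  · rw [div_mul_eq_mul_div, le_div_iff₀ (by linarith)]
    linarith
  · rw [div_mul_eq_mul_div, le_div_iff₀ (by linarith)]
    linarith

theorem exists_pos_of_area_pos {R : Set (ℝ × ℝ)} (hpos : ∀ x y, (x, y) ∈ R → 0 ≤ y)
    (h : 0 < ∫ _ in R, (1 : ℝ)) : ∃ x y, (x, y) ∈ R ∧ 0 < y := by
  by_contra! hne
  have h0 : volume R = 0 := by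
    refine measure_mono_null ?_ (volume_affine_line_eq_zero (a := 0) (b := 1) 0 (by norm_num))
    rintro ⟨x, y⟩ hq
    change 0 * x + 1 * y = 0
    linarith [hpos x y hq, hne x y hq]
  rw [setIntegral_measure_zero _ h0] at h
  exact h.false

theorem quadrant_second_moment_le {Q Q' : Set (ℝ × ℝ)} (hQ : IsCompact Q) (hc : Convex ℝ Q)
    (hpos : ∀ x y, (x, y) ∈ Q → 0 ≤ x ∧ 0 ≤ y) (h0 : ((0 : ℝ), (0 : ℝ)) ∈ Q)
    (h1 : ((1 : ℝ), (0 : ℝ)) ∈ Q) (h2 : ((0 : ℝ), (1 : ℝ)) ∈ Q) (hQ' : IsCompact Q')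
    (hc' : Convex ℝ Q') (hpos' : ∀ x y, (x, y) ∈ Q' → 0 ≤ x ∧ 0 ≤ y)
    (h0' : ((0 : ℝ), (0 : ℝ)) ∈ Q') (h1' : ((1 : ℝ), (0 : ℝ)) ∈ Q')
    (h2' : ((0 : ℝ), (1 : ℝ)) ∈ Q') {ε δ a : ℝ} (hε : |ε| ≤ 1) (hδ : |δ| ≤ 1)
    (hsub : ∀ x y, (x, y) ∈ Q → x ≤ 1 + ε * y ∧ y ≤ 1 + δ * x)
    (hsub' : ∀ x y, (x, y) ∈ Q' → x ≤ 1 + -ε * y ∧ y ≤ 1 + -δ * x)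
    (ha : ∫ _ in Q, (1 : ℝ) = a) (ha' : ∫ _ in Q', (1 : ℝ) = a) :
    ∫ q in Q, (q.1 ^ 2 + q.2 ^ 2) ≤ 2 / 3 * a ^ 2 := by
  rw [corner_second_moment hQ hc hpos h0 h1 h2]
  rw [corner_area hQ hc hpos h0 h1 h2] at ha
  rw [corner_area hQ' hc' hpos' h0' h1' h2'] at ha'
  obtain ⟨k, rfl⟩ : ∃ k, a = 1 / 2 + k := ⟨a - 1 / 2, by ring⟩
  have hk : ∫ _ in cornerCap Q, (1 : ℝ) = k / 2 := by linarith
  have hk' : ∫ _ in cornerCap Q', (1 : ℝ) = k / 2 := by linarith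
  have hk0 : 0 ≤ k := by
    have : 0 ≤ ∫ _ in cornerCap Q, (1 : ℝ) := integral_nonneg fun _ => zero_le_one
    linarith
  rcases hk0.eq_or_lt with rfl | hk0
  · have hv : volume (cornerCap Q) = 0 := by
      simp only [integral_const, MeasurableSet.univ, measureReal_restrict_apply, univ_inter,
        smul_eq_mul, mul_one, zero_div] at hk
      exact (measureReal_eq_zero_iff (isCompact_cornerCap hQ).measure_lt_top.ne).1 hk
    rw [setIntegral_measure_zero _ hv]
    norm_num
  obtain ⟨x, y, ⟨-, hxy⟩, hy⟩ := exists_pos_of_area_pos (R := cornerCap Q) (fun x y h => h.1)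
    (by rw [hk]; linarith)
  obtain ⟨x', y', ⟨-, hxy'⟩, hy'⟩ := exists_pos_of_area_pos (R := cornerCap Q') (fun x y h => h.1)
    (by rw [hk']; linarith)
  have hs := hsub _ _ hxy
  have hs' := hsub' _ _ hxy'
  have hp := hpos _ _ hxy
  have hp' := hpos' _ _ hxy'
  simp only at hs hs' hp hp' hy hy'
  rw [abs_le] at hε hδ
  have hε' : -1 < ε ∧ ε < 1 := by
    refine ⟨lt_of_le_of_ne hε.1 ?_, lt_of_le_of_ne hε.2 ?_⟩
    · rintro rfl; linarith
    · rintro rfl; linarith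
  have hδ' : -1 < δ ∧ δ < 1 := by
    refine ⟨lt_of_le_of_ne hδ.1 ?_, lt_of_le_of_ne hδ.2 ?_⟩
    · rintro rfl; linarith
    · rintro rfl; linarith
  have hε1 : 0 < 1 - ε := by linarith
  have hε2 : 0 < 1 + ε := by linarith
  have hδ1 : 0 < 1 - δ := by linarith
  have hδ2 : 0 < 1 + δ := by linarith
  have hb0 : ((0 : ℝ), (0 : ℝ)) ∈ cornerCap Q := mem_cornerCap.2 ⟨le_rfl, by simpa⟩
  have hb1 : ((1 : ℝ), (0 : ℝ)) ∈ cornerCap Q := mem_cornerCap.2 ⟨le_rfl, by simpa⟩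
  have hb0' : ((0 : ℝ), (0 : ℝ)) ∈ cornerCap Q' := mem_cornerCap.2 ⟨le_rfl, by simpa⟩
  have hb1' : ((1 : ℝ), (0 : ℝ)) ∈ cornerCap Q' := mem_cornerCap.2 ⟨le_rfl, by simpa⟩
  have hB := cap_bounds (isCompact_cornerCap hQ) (convex_cornerCap hc) hb0 hb1
    (div_pos hε2 hε1) (div_pos hδ2 hδ1) (corner_slopes hε' hδ' hsub) hk
  have hB' := (cap_bounds (isCompact_cornerCap hQ') (convex_cornerCap hc') hb0' hb1'
    (m := (1 + -ε) / (1 - -ε)) (n := (1 + -δ) / (1 - -δ))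
    (div_pos (by linarith) (by linarith)) (div_pos (by linarith) (by linarith))
    (corner_slopes ⟨by linarith, by linarith⟩ ⟨by linarith, by linarith⟩ hsub') hk').1
  have hmn : k * ((1 + ε) / (1 - ε) + (1 + δ) / (1 - δ)) ≤ 1 := by
    rw [sub_neg_eq_add, sub_neg_eq_add, ← sub_eq_add_neg, ← sub_eq_add_neg, div_mul_div_comm,
      div_add_div _ _ hε2.ne' hδ2.ne', mul_div_assoc', div_le_div_iff_of_pos_right (by positivity)]
      at hB'
    rw [div_add_div _ _ hε1.ne' hδ1.ne', mul_div_assoc', div_le_one (by positivity)]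
    linarith
  have := hB.2 hk0 hmn
  linarith

theorem exists_support_functional {K : Set (ℝ × ℝ)} (hc : Convex ℝ K)
    (h0 : (0 : ℝ × ℝ) ∈ interior K) {e : ℝ × ℝ} (he : ∀ t : ℝ, t • e ∈ K → t ≤ 1) :
    ∃ p r : ℝ, p * e.1 + r * e.2 = 1 ∧ ∀ x y, (x, y) ∈ K → p * x + r * y ≤ 1 := by
  have hni : e ∉ interior K := by
    intro hi
    have hcont : Continuous fun t : ℝ => t • e := by fun_prop
    have hev : ∀ᶠ t in nhds (1 : ℝ), t • e ∈ interior K :=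
      hcont.continuousAt.eventually_mem (isOpen_interior.mem_nhds (by simpa using hi))
    obtain ⟨η, hη, hball⟩ := Metric.eventually_nhds_iff.1 hev
    have h := he (1 + η / 2) (interior_subset (hball (by
      rw [Real.dist_eq, add_sub_cancel_left, abs_of_pos (by linarith)]
      linarith)))
    linarith
  obtain ⟨f, hf⟩ := geometric_hahn_banach_open_point hc.interior isOpen_interior hni
  have hpos : 0 < f e := by simpa using hf 0 h0
  have hle : ∀ q ∈ K, f q ≤ f e := by
    intro q hq
    have hcl : q ∈ closure (interior K) := by
      rw [hc.closure_interior_eq_closure_of_nonempty_interior ⟨0, h0⟩]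
      exact subset_closure hq
    exact closure_minimal (fun a ha => (hf a ha).le)
      (isClosed_le f.continuous continuous_const) hcl
  have hlin : ∀ q : ℝ × ℝ, f q = f (1, 0) * q.1 + f (0, 1) * q.2 := by
    rintro ⟨x, y⟩
    have : ((x, y) : ℝ × ℝ) = x • (1, 0) + y • (0, 1) := by simp
    rw [this, map_add, map_smul, map_smul]
    simp [mul_comm]
  refine ⟨f (1, 0) / f e, f (0, 1) / f e, ?_, fun x y hxy => ?_⟩
  · rw [div_mul_eq_mul_div, div_mul_eq_mul_div, ← add_div, ← hlin, div_self hpos.ne']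
  · rw [div_mul_eq_mul_div, div_mul_eq_mul_div, ← add_div, ← hlin (x, y)]
    exact (div_le_one hpos).2 (hle _ hxy)

theorem setIntegral_symm_eq_two_mul {K : Set (ℝ × ℝ)} (hK : IsCompact K)
    (hsym : ∀ q, -q ∈ K ↔ q ∈ K) {F : ℝ × ℝ → ℝ} (hF : Continuous F)
    (hFe : ∀ x y, F (-x, -y) = F (x, y)) :
    ∫ q in K, F q = 2 * ∫ q in K ∩ {q | 0 ≤ q.2}, F q := by
  have h := setIntegral_eq_add_of_line hK hF (a := 0) (b := 1) 0 (by norm_num)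
  rw [setIntegral_linear_change (a := -1) (b := 0) (c := 0) (d := -1) (by norm_num)
    (K ∩ {q | 0 * q.1 + 1 * q.2 ≤ 0}) F 0 0] at h
  have hs : (fun q : ℝ × ℝ => (-1 * q.1 + 0 * q.2 + 0, 0 * q.1 + -1 * q.2 + 0)) ⁻¹'
      (K ∩ {q | 0 * q.1 + 1 * q.2 ≤ 0}) = K ∩ {q | 0 ≤ q.2} := by
    ext ⟨x, y⟩
    have := hsym (x, y)
    simpa using fun _ => this
  rw [hs] at h
  have hs' : K ∩ {q | 0 ≤ 0 * q.1 + 1 * q.2} = K ∩ {q | 0 ≤ q.2} := by simp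
  rw [hs'] at h
  have hFe' : ∀ q : ℝ × ℝ, F (-1 * q.1 + 0 * q.2 + 0, 0 * q.1 + -1 * q.2 + 0) = F q := by
    rintro ⟨x, y⟩
    simpa using hFe x y
  simp only [hFe'] at h
  rw [h]
  norm_num
  ring

theorem normalized_second_moment_le {K : Set (ℝ × ℝ)} (hK : IsCompact K) (hc : Convex ℝ K)
    (hsym : ∀ q, -q ∈ K ↔ q ∈ K) (h0 : (0 : ℝ × ℝ) ∈ interior K)
    (h1 : ((1 : ℝ), (0 : ℝ)) ∈ K) (h2 : ((0 : ℝ), (1 : ℝ)) ∈ K)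
    (ht1 : ∀ t : ℝ, (t, (0 : ℝ)) ∈ K → t ≤ 1) (ht2 : ∀ t : ℝ, ((0 : ℝ), t) ∈ K → t ≤ 1)
    (ha : ∫ _ in K ∩ {q | 0 ≤ q.2} ∩ {q | 0 ≤ q.1}, (1 : ℝ) =
      ∫ _ in K ∩ {q | 0 ≤ q.2} ∩ {q | q.1 ≤ 0}, (1 : ℝ)) :
    ∫ q in K, (q.1 ^ 2 + q.2 ^ 2) ≤ (∫ _ in K, (1 : ℝ)) ^ 2 / 6 := by
  have h00 : ((0 : ℝ), (0 : ℝ)) ∈ K := interior_subset h0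
  have h1' : ((-1 : ℝ), (0 : ℝ)) ∈ K := by simpa using (hsym (1, 0)).2 h1
  have h2' : ((0 : ℝ), (-1 : ℝ)) ∈ K := by simpa using (hsym (0, 1)).2 h2
  obtain ⟨p, r, hpr, hx⟩ := exists_support_functional hc h0 (e := (1, 0)) (by simpa using ht1)
  obtain ⟨p', r', hpr', hy⟩ := exists_support_functional hc h0 (e := (0, 1)) (by simpa using ht2)
  obtain rfl : p = 1 := by simpa using hpr
  obtain rfl : r' = 1 := by simpa using hpr'
  have hr : |-r| ≤ 1 := by
    rw [abs_le]
    constructor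
    · linarith [hx _ _ h2]
    · linarith [hx _ _ h2']
  have hp' : |-p'| ≤ 1 := by
    rw [abs_le]
    constructor
    · linarith [hy _ _ h1]
    · linarith [hy _ _ h1']
  have hKp : IsCompact (K ∩ {q | 0 ≤ q.2}) :=
    hK.inter_right (isClosed_le continuous_const continuous_snd)
  set Q := K ∩ {q : ℝ × ℝ | 0 ≤ q.2} ∩ {q | 0 ≤ q.1} with hQ
  set Q' := (fun q : ℝ × ℝ => (-q.1, q.2)) ⁻¹' (K ∩ {q : ℝ × ℝ | 0 ≤ q.2} ∩ {q | q.1 ≤ 0}) with hQ'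
  have hrefl : ∀ F : ℝ × ℝ → ℝ, ∫ q in K ∩ {q : ℝ × ℝ | 0 ≤ q.2} ∩ {q | q.1 ≤ 0}, F q =
      ∫ q in Q', F (-q.1, q.2) := by
    intro F
    rw [setIntegral_linear_change (a := -1) (b := 0) (c := 0) (d := 1) (by norm_num) _ F 0 0]
    simp [hQ']
  have hsplit : ∀ F : ℝ × ℝ → ℝ, Continuous F → (∀ x y, F (-x, -y) = F (x, y)) →
      ∫ q in K, F q = 2 * ((∫ q in Q, F q) + ∫ q in Q', F (-q.1, q.2)) := by
    intro F hF hFe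
    rw [setIntegral_symm_eq_two_mul hK hsym hF hFe,
      setIntegral_eq_add_of_line hKp hF (a := 1) (b := 0) 0 (by norm_num), ← hrefl, hQ]
    simp
  have memQ : ∀ x y, (x, y) ∈ Q ↔ (x, y) ∈ K ∧ 0 ≤ x ∧ 0 ≤ y := fun x y =>
    ⟨fun h => ⟨h.1.1, h.2, h.1.2⟩, fun h => ⟨⟨h.1, h.2.2⟩, h.2.1⟩⟩
  have memQ' : ∀ x y, (x, y) ∈ Q' ↔ (-x, y) ∈ K ∧ 0 ≤ x ∧ 0 ≤ y := fun x y =>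
    ⟨fun h => ⟨h.1.1, neg_nonpos.1 h.2, h.1.2⟩, fun h => ⟨⟨h.1, h.2.2⟩, neg_nonpos.2 h.2.1⟩⟩
  have hQc : IsCompact Q := hKp.inter_right (isClosed_le continuous_const continuous_fst)
  have hQ'c : IsCompact Q' := by
    let φ : ℝ × ℝ ≃ₜ ℝ × ℝ := (Homeomorph.neg ℝ).prodCongr (Homeomorph.refl ℝ)
    exact φ.isCompact_preimage.2
      (hKp.inter_right (isClosed_le continuous_fst continuous_const))
  have hQconv : Convex ℝ Q := by
    rintro ⟨x, y⟩ hq ⟨x', y'⟩ hq' a b ha hb hab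
    rw [memQ] at hq hq'
    exact (memQ _ _).2 ⟨hc hq.1 hq'.1 ha hb hab, add_nonneg (mul_nonneg ha hq.2.1)
      (mul_nonneg hb hq'.2.1), add_nonneg (mul_nonneg ha hq.2.2) (mul_nonneg hb hq'.2.2)⟩
  have hQ'conv : Convex ℝ Q' := by
    rintro ⟨x, y⟩ hq ⟨x', y'⟩ hq' a b ha hb hab
    rw [memQ'] at hq hq'
    refine (memQ' _ _).2 ⟨?_, add_nonneg (mul_nonneg ha hq.2.1)
      (mul_nonneg hb hq'.2.1), add_nonneg (mul_nonneg ha hq.2.2) (mul_nonneg hb hq'.2.2)⟩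
    convert hc hq.1 hq'.1 ha hb hab using 1
    ext
    · simp
      ring
    · simp
  rw [hrefl fun _ => 1] at ha
  have hV := hsplit (fun _ => 1) continuous_const fun _ _ => rfl
  have hM := hsplit (fun q => q.1 ^ 2 + q.2 ^ 2) (by fun_prop) fun x y => by ring
  simp only [neg_sq] at hM
  have e0 : ((0 : ℝ), (0 : ℝ)) ∈ Q := (memQ _ _).2 ⟨h00, le_rfl, le_rfl⟩
  have e1 : ((1 : ℝ), (0 : ℝ)) ∈ Q := (memQ _ _).2 ⟨h1, zero_le_one, le_rfl⟩
  have e2 : ((0 : ℝ), (1 : ℝ)) ∈ Q := (memQ _ _).2 ⟨h2, le_rfl, zero_le_one⟩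
  have e0' : ((0 : ℝ), (0 : ℝ)) ∈ Q' := (memQ' _ _).2 ⟨by simpa using h00, le_rfl, le_rfl⟩
  have e1' : ((1 : ℝ), (0 : ℝ)) ∈ Q' := (memQ' _ _).2 ⟨h1', zero_le_one, le_rfl⟩
  have e2' : ((0 : ℝ), (1 : ℝ)) ∈ Q' := (memQ' _ _).2 ⟨by simpa using h2, le_rfl, zero_le_one⟩
  have hs : ∀ x y, (x, y) ∈ Q → x ≤ 1 + -r * y ∧ y ≤ 1 + -p' * x := fun x y h => by
    have h := ((memQ x y).1 h).1
    constructor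
    · linarith [hx x y h]
    · linarith [hy x y h]
  have hs' : ∀ x y, (x, y) ∈ Q' → x ≤ 1 + r * y ∧ y ≤ 1 + p' * x := fun x y h => by
    have h := (hsym _).2 ((memQ' x y).1 h).1
    have h' : (x, -y) ∈ K := by simpa using h
    have h'' := ((memQ' x y).1 ‹_›).1
    constructor
    · linarith [hx _ _ h']
    · linarith [hy _ _ h'']
  have b1 := quadrant_second_moment_le hQc hQconv (fun x y h => ((memQ x y).1 h).2) e0 e1 e2
    hQ'c hQ'conv (fun x y h => ((memQ' x y).1 h).2) e0' e1' e2' hr hp' hs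
    (by simpa only [neg_neg] using hs') ha rfl
  have b2 := quadrant_second_moment_le hQ'c hQ'conv (fun x y h => ((memQ' x y).1 h).2) e0' e1' e2'
    hQc hQconv (fun x y h => ((memQ x y).1 h).2) e0 e1 e2 (by rwa [abs_neg] at hr)
    (by rwa [abs_neg] at hp') hs' hs rfl ha
  rw [ha] at hV
  rw [hV, hM]
  linarith

theorem exists_halving_slope {P : Set (ℝ × ℝ)} (hP : IsCompact P)
    (hpos : ∀ x y, (x, y) ∈ P → 0 ≤ y) (hV : 0 < ∫ _ in P, (1 : ℝ)) :
    ∃ c : ℝ, ∫ _ in P ∩ {q | c * q.2 ≤ q.1}, (1 : ℝ) = ∫ _ in P ∩ {q | q.1 ≤ c * q.2}, (1 : ℝ) := by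
  set g : ℝ → ℝ × ℝ → ℝ := fun c => {q : ℝ × ℝ | c * q.2 ≤ q.1}.indicator fun _ => 1 with hg
  have hm : ∀ c : ℝ, MeasurableSet {q : ℝ × ℝ | c * q.2 ≤ q.1} := fun c =>
    (isClosed_le (by fun_prop) continuous_fst).measurableSet
  have hA : ∀ c, ∫ _ in P ∩ {q | c * q.2 ≤ q.1}, (1 : ℝ) = ∫ q in P, g c q := fun c =>
    (setIntegral_indicator (hm c)).symm
  have hgm : ∀ c, AEStronglyMeasurable (g c) (volume.restrict P) := fun c =>
    (measurable_const.indicator (hm c)).aestronglyMeasurable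
  have hgb : ∀ c q, ‖g c q‖ ≤ 1 := by
    intro c q
    simp only [hg, indicator_apply]
    split_ifs <;> simp
  have hone : Integrable (fun _ : ℝ × ℝ => (1 : ℝ)) (volume.restrict P) :=
    continuousOn_const.integrableOn_compact hP
  have hg1 : ∀ c q, c * q.2 ≤ q.1 → g c q = 1 := fun c q h =>
    indicator_of_mem (s := {q : ℝ × ℝ | c * q.2 ≤ q.1}) h _
  have hg0 : ∀ c q, q.1 < c * q.2 → g c q = 0 := fun c q h =>
    indicator_of_notMem (s := {q : ℝ × ℝ | c * q.2 ≤ q.1}) (fun h' => absurd h (not_lt.2 h')) _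
  have hline : ∀ a b : ℝ, a ^ 2 + b ^ 2 ≠ 0 →
      ∀ᵐ q ∂(volume.restrict P), a * q.1 + b * q.2 ≠ 0 := fun a b hab =>
    ae_restrict_of_ae (measure_eq_zero_iff_ae_notMem.1 (volume_affine_line_eq_zero 0 hab))
  have hy0 : ∀ᵐ q ∂(volume.restrict P), 0 < q.2 := by
    filter_upwards [hline 0 1 (by norm_num), ae_restrict_mem hP.measurableSet] with q hq hqP
    exact lt_of_le_of_ne (hpos _ _ hqP) fun h => hq (by rw [← h]; ring)
  have hcont : Continuous fun c => ∫ q in P, g c q := by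
    rw [continuous_iff_continuousAt]
    intro c
    refine continuousAt_of_dominated (bound := fun _ => 1) (Filter.Eventually.of_forall hgm)
      (Filter.Eventually.of_forall fun c => Filter.Eventually.of_forall (hgb c)) hone ?_
    filter_upwards [hline 1 (-c) (by positivity)] with q hq
    have hcq : Continuous fun c : ℝ => c * q.2 := by fun_prop
    rcases lt_or_gt_of_ne (fun h => hq (by rw [h]; ring) : q.1 ≠ c * q.2) with h | h
    · refine continuousAt_const.congr (f := fun _ => (0 : ℝ)) ?_
      filter_upwards [hcq.continuousAt.eventually (lt_mem_nhds h)] with d hd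
      exact (hg0 d q hd).symm
    · refine continuousAt_const.congr (f := fun _ => (1 : ℝ)) ?_
      filter_upwards [hcq.continuousAt.eventually (gt_mem_nhds h)] with d hd
      exact (hg1 d q hd.le).symm
  have htop : Filter.Tendsto (fun c => ∫ q in P, g c q) Filter.atTop (nhds (∫ _ in P, (0 : ℝ))) := by
    refine tendsto_integral_filter_of_dominated_convergence (fun _ => 1)
      (Filter.Eventually.of_forall hgm)
      (Filter.Eventually.of_forall fun c => Filter.Eventually.of_forall (hgb c)) hone ?_
    filter_upwards [hy0] with q hq
    refine tendsto_const_nhds.congr' ?_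
    filter_upwards [Filter.eventually_gt_atTop (q.1 / q.2)] with d hd
    exact (hg0 d q ((div_lt_iff₀ hq).1 hd)).symm
  have hbot : Filter.Tendsto (fun c => ∫ q in P, g c q) Filter.atBot (nhds (∫ _ in P, (1 : ℝ))) := by
    refine tendsto_integral_filter_of_dominated_convergence (fun _ => 1)
      (Filter.Eventually.of_forall hgm)
      (Filter.Eventually.of_forall fun c => Filter.Eventually.of_forall (hgb c)) hone ?_
    filter_upwards [hy0] with q hq
    refine tendsto_const_nhds.congr' ?_
    filter_upwards [Filter.eventually_le_atBot (q.1 / q.2)] with d hd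
    exact (hg1 d q ((le_div_iff₀ hq).1 hd)).symm
  rw [integral_zero] at htop
  obtain ⟨c₁, h₁⟩ := (htop.eventually (gt_mem_nhds (half_pos hV))).exists
  obtain ⟨c₂, h₂⟩ := (hbot.eventually (lt_mem_nhds (half_lt_self hV))).exists
  obtain ⟨c, hc⟩ := mem_range_of_exists_le_of_exists_ge hcont ⟨c₁, h₁.le⟩ ⟨c₂, h₂.le⟩
  refine ⟨c, ?_⟩
  have hsplit := setIntegral_eq_add_of_line hP (F := fun _ => 1) continuous_const
    (a := 1) (b := -c) 0 (by positivity)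
  have e1 : {q : ℝ × ℝ | 0 ≤ 1 * q.1 + -c * q.2} = {q | c * q.2 ≤ q.1} := by
    ext q
    change 0 ≤ 1 * q.1 + -c * q.2 ↔ c * q.2 ≤ q.1
    constructor <;> intro h <;> linarith
  have e2 : {q : ℝ × ℝ | 1 * q.1 + -c * q.2 ≤ 0} = {q | q.1 ≤ c * q.2} := by
    ext q
    change 1 * q.1 + -c * q.2 ≤ 0 ↔ q.1 ≤ c * q.2
    constructor <;> intro h <;> linarith
  rw [e1, e2, hA c] at hsplit
  rw [hA c]
  simp only at hc hsplit
  linarith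

theorem exists_max_dilation {K : Set (ℝ × ℝ)} (hK : IsCompact K) (h0 : (0 : ℝ × ℝ) ∈ interior K)
    {e : ℝ × ℝ} (he : e ≠ 0) : ∃ α : ℝ, 0 < α ∧ α • e ∈ K ∧ ∀ t : ℝ, t • e ∈ K → t ≤ α := by
  have hcont : Continuous fun t : ℝ => t • e := by fun_prop
  have hS : IsCompact ((fun t : ℝ => t • e) ⁻¹' K) :=
    (isClosedEmbedding_smul_left he).isCompact_preimage hK
  have hev : ∀ᶠ t in nhds (0 : ℝ), t • e ∈ interior K :=
    hcont.continuousAt.eventually_mem (isOpen_interior.mem_nhds (by simpa using h0))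
  obtain ⟨η, hη, hball⟩ := Metric.eventually_nhds_iff.1 hev
  have hmem : (η / 2) • e ∈ K := interior_subset (hball (y := η / 2) (by
    rw [Real.dist_eq, sub_zero, abs_of_pos (by linarith)]
    linarith))
  exact ⟨_, (half_pos hη).trans_le (le_csSup hS.bddAbove hmem), hS.sSup_mem ⟨_, hmem⟩,
    fun t ht => le_csSup hS.bddAbove ht⟩

theorem second_moment_det_le {K : Set (ℝ × ℝ)} (hK : IsCompact K) (hc : Convex ℝ K)
    (hsym : ∀ q, -q ∈ K ↔ q ∈ K) (h0 : (0 : ℝ × ℝ) ∈ interior K)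
    (hV : 0 < ∫ _ in K, (1 : ℝ)) :
    144 * ((∫ q in K, q.1 * q.1) * (∫ q in K, q.2 * q.2) - (∫ q in K, q.1 * q.2) ^ 2) ≤
      (∫ _ in K, (1 : ℝ)) ^ 4 := by
  have hKp : IsCompact (K ∩ {q | 0 ≤ q.2}) :=
    hK.inter_right (isClosed_le continuous_const continuous_snd)
  obtain ⟨c, hc2⟩ := exists_halving_slope hKp (fun x y h => h.2) (by
    rw [setIntegral_symm_eq_two_mul hK hsym continuous_const fun _ _ => rfl] at hV
    linarith)
  obtain ⟨α, hα, hαK, hαmax⟩ := exists_max_dilation hK h0 (e := (1, 0)) (by simp)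
  obtain ⟨β, hβ, hβK, hβmax⟩ := exists_max_dilation hK h0 (e := (c, 1)) (by simp)
  set T : ℝ × ℝ → ℝ × ℝ := fun q => (α * q.1 + c * β * q.2, β * q.2) with hT
  have hTc : Continuous T := by fun_prop
  have hchange : ∀ (P : Set (ℝ × ℝ)) (F : ℝ × ℝ → ℝ),
      ∫ q in P, F q = α * β * ∫ q in T ⁻¹' P, F (T q) := by
    intro P F
    have hab : α * β - c * β * 0 ≠ 0 := by
      rw [mul_zero, sub_zero]
      exact (mul_pos hα hβ).ne'
    rw [setIntegral_linear_change hab P F 0 0]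
    simp [hT, abs_of_pos hα, abs_of_pos hβ]
  have hK' : IsCompact (T ⁻¹' K) := by
    have : T ⁻¹' K = (fun q : ℝ × ℝ => ((q.1 - c * q.2) / α, q.2 / β)) '' K := by
      ext q
      constructor
      · intro h
        refine ⟨_, h, ?_⟩
        ext <;> simp only [hT] <;> field_simp
        ring
      · rintro ⟨p, hp, rfl⟩
        have : T ((p.1 - c * p.2) / α, p.2 / β) = p := by
          ext <;> simp only [hT] <;> field_simp
          ring
        rwa [mem_preimage, this]
    rw [this]
    exact hK.image (by fun_prop)
  have hconv : Convex ℝ (T ⁻¹' K) := by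
    intro p hp q hq a b ha hb hab
    have := hc hp hq ha hb hab
    rw [mem_preimage]
    convert this using 1
    ext <;> simp [hT] <;> ring
  have hsym' : ∀ q, -q ∈ T ⁻¹' K ↔ q ∈ T ⁻¹' K := by
    intro q
    rw [mem_preimage, mem_preimage, ← hsym (T q)]
    have : T (-q) = -T q := by ext <;> simp [hT]; ring
    rw [this]
  have h0' : (0 : ℝ × ℝ) ∈ interior (T ⁻¹' K) := by
    refine preimage_interior_subset_interior_preimage hTc ?_
    have : T 0 = 0 := by simp [hT]
    rwa [mem_preimage, this]
  have hle := normalized_second_moment_le hK' hconv hsym' h0'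
    (by simpa [hT] using hαK) (by simpa [hT, mul_comm] using hβK)
    (fun t ht => by
      have := hαmax (α * t) (by simpa [hT] using ht)
      exact le_of_mul_le_mul_left (by linarith) hα)
    (fun t ht => by
      have := hβmax (β * t) (by
        have ht' : (α * 0 + c * β * t, β * t) ∈ K := ht
        simpa [mul_comm, mul_left_comm, mul_assoc] using ht')
      exact le_of_mul_le_mul_left (by linarith) hβ)
    (by
      rw [hchange, hchange (K ∩ {q | 0 ≤ q.2} ∩ {q | q.1 ≤ c * q.2})] at hc2
      have hc3 := mul_left_cancel₀ (mul_pos hα hβ).ne' hc2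
      have e1 : T ⁻¹' (K ∩ {q | 0 ≤ q.2} ∩ {q | c * q.2 ≤ q.1}) =
          T ⁻¹' K ∩ {q | 0 ≤ q.2} ∩ {q | 0 ≤ q.1} := by
        ext q
        simp only [hT, mem_preimage, mem_inter_iff, mem_ofPred_eq, mul_nonneg_iff_of_pos_left hβ]
        exact and_congr_right fun _ =>
          ⟨fun h => le_of_mul_le_mul_left (by linarith) hα, fun h => by nlinarith⟩
      have e2 : T ⁻¹' (K ∩ {q | 0 ≤ q.2} ∩ {q | q.1 ≤ c * q.2}) =
          T ⁻¹' K ∩ {q | 0 ≤ q.2} ∩ {q | q.1 ≤ 0} := by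
        ext q
        simp only [hT, mem_preimage, mem_inter_iff, mem_ofPred_eq, mul_nonneg_iff_of_pos_left hβ]
        exact and_congr_right fun _ =>
          ⟨fun h => le_of_mul_le_mul_left (by linarith) hα, fun h => by nlinarith⟩
      rwa [e1, e2] at hc3)
  have hint : ∀ {F : ℝ × ℝ → ℝ}, Continuous F → IntegrableOn F (T ⁻¹' K) := fun hF =>
    hF.continuousOn.integrableOn_compact hK'
  have hlin : ∀ a b d : ℝ, ∫ q in T ⁻¹' K, (a * q.1 ^ 2 + b * (q.1 * q.2) + d * q.2 ^ 2) =
      a * (∫ q in T ⁻¹' K, q.1 ^ 2) + b * (∫ q in T ⁻¹' K, q.1 * q.2) +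
        d * ∫ q in T ⁻¹' K, q.2 ^ 2 := by
    intro a b d
    rw [integral_add (hint (by fun_prop)) (hint (by fun_prop)),
      integral_add (hint (by fun_prop)) (hint (by fun_prop)), integral_const_mul,
      integral_const_mul, integral_const_mul]
  have hquad : ∀ (F : ℝ × ℝ → ℝ) (a b d : ℝ),
      (∀ q, F (T q) = a * q.1 ^ 2 + b * (q.1 * q.2) + d * q.2 ^ 2) →
      ∫ q in K, F q = α * β * (a * (∫ q in T ⁻¹' K, q.1 ^ 2) +
        b * (∫ q in T ⁻¹' K, q.1 * q.2) + d * ∫ q in T ⁻¹' K, q.2 ^ 2) := by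
    intro F a b d hF
    rw [hchange, ← hlin]
    simp only [hF]
  have e11 := hquad (fun q => q.1 * q.1) (α ^ 2) (2 * α * (c * β)) ((c * β) ^ 2)
    (fun q => by simp only [hT]; ring)
  have e12 := hquad (fun q => q.1 * q.2) 0 (α * β) (c * β ^ 2) (fun q => by simp only [hT]; ring)
  have e22 := hquad (fun q => q.2 * q.2) 0 0 (β ^ 2) (fun q => by simp only [hT]; ring)
  have p11 : 0 ≤ ∫ q in T ⁻¹' K, q.1 ^ 2 := integral_nonneg fun q => sq_nonneg q.1
  have p22 : 0 ≤ ∫ q in T ⁻¹' K, q.2 ^ 2 := integral_nonneg fun q => sq_nonneg q.2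
  rw [integral_add (hint (by fun_prop)) (hint (by fun_prop))] at hle
  rw [e11, e12, e22, hchange K fun _ => 1]
  generalize ∫ q in T ⁻¹' K, q.1 ^ 2 = m₁₁ at *
  generalize ∫ q in T ⁻¹' K, q.2 ^ 2 = m₂₂ at *
  generalize ∫ q in T ⁻¹' K, q.1 * q.2 = m₁₂ at *
  generalize ∫ q in T ⁻¹' K, (1 : ℝ) = v at *
  have h1 : (m₁₁ + m₂₂) ^ 2 ≤ (v ^ 2 / 6) ^ 2 := pow_le_pow_left₀ (by positivity) hle 2
  have h2 : 144 * (m₁₁ * m₂₂ - m₁₂ ^ 2) ≤ v ^ 4 := by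
    nlinarith [sq_nonneg (m₁₁ - m₂₂), sq_nonneg m₁₂]
  have h3 := mul_le_mul_of_nonneg_left h2 (show 0 ≤ (α * β) ^ 4 by positivity)
  calc _ = (α * β) ^ 4 * (144 * (m₁₁ * m₂₂ - m₁₂ ^ 2)) := by ring
    _ ≤ (α * β) ^ 4 * v ^ 4 := h3
    _ = _ := by ring

theorem setIntegral_sq_pos {K : Set (ℝ × ℝ)} (hK : IsCompact K) (hV : 0 < ∫ _ in K, (1 : ℝ))
    {a b : ℝ} (hab : a ^ 2 + b ^ 2 ≠ 0) : 0 < ∫ q in K, (a * q.1 + b * q.2) ^ 2 := by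
  rw [setIntegral_pos_iff_support_of_nonneg_ae
    (Filter.Eventually.of_forall fun q => sq_nonneg (a * q.1 + b * q.2))
    ((by fun_prop : Continuous fun q : ℝ × ℝ => (a * q.1 + b * q.2) ^ 2).continuousOn
      |>.integrableOn_compact hK)]
  refine pos_iff_ne_zero.2 fun h => hV.ne' ?_
  rw [setIntegral_measure_zero _ ?_]
  refine measure_mono_null (t := (Function.support (fun q : ℝ × ℝ => (a * q.1 + b * q.2) ^ 2) ∩ K) ∪
    {q | a * q.1 + b * q.2 = 0}) ?_ (measure_union_null h (volume_affine_line_eq_zero 0 hab))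
  intro q hq
  by_cases hl : a * q.1 + b * q.2 = 0
  · exact Or.inr hl
  · exact Or.inl ⟨pow_ne_zero 2 hl, hq⟩

theorem second_moment_det_pos {K : Set (ℝ × ℝ)} (hK : IsCompact K)
    (hV : 0 < ∫ _ in K, (1 : ℝ)) :
    0 < (∫ q in K, q.1 * q.1) * (∫ q in K, q.2 * q.2) - (∫ q in K, q.1 * q.2) ^ 2 := by
  have hint : ∀ {F : ℝ × ℝ → ℝ}, Continuous F → IntegrableOn F K := fun hF =>
    hF.continuousOn.integrableOn_compact hK
  have hlin : ∀ a b : ℝ, ∫ q in K, (a * q.1 + b * q.2) ^ 2 =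
      a ^ 2 * (∫ q in K, q.1 * q.1) + 2 * a * b * (∫ q in K, q.1 * q.2) +
        b ^ 2 * ∫ q in K, q.2 * q.2 := by
    intro a b
    rw [← integral_const_mul, ← integral_const_mul, ← integral_const_mul,
      ← integral_add (hint (F := fun q => a ^ 2 * (q.1 * q.1)) (by fun_prop))
        (hint (F := fun q => 2 * a * b * (q.1 * q.2)) (by fun_prop)),
      ← integral_add (hint (by fun_prop)) (hint (F := fun q => b ^ 2 * (q.2 * q.2)) (by fun_prop))]
    congr 1
    funext q
    ring
  have h22 := setIntegral_sq_pos hK hV (a := 0) (b := 1) (by norm_num)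
  rw [hlin] at h22
  generalize ∫ q in K, q.1 * q.1 = m₁₁ at *
  generalize ∫ q in K, q.2 * q.2 = m₂₂ at *
  generalize ∫ q in K, q.1 * q.2 = m₁₂ at *
  have h22' : 0 < m₂₂ := by linarith
  have h := setIntegral_sq_pos hK hV (a := m₂₂) (b := -m₁₂) (by positivity)
  rw [hlin] at h
  refine pos_of_mul_pos_right (a := m₂₂) ?_ h22'.le
  linarith

theorem setIntegral_odd_eq_zero {K : Set (ℝ × ℝ)} (hsym : ∀ q, -q ∈ K ↔ q ∈ K)
    {F : ℝ × ℝ → ℝ} (hF : ∀ q, F (-q) = -F q) : ∫ q in K, F q = 0 := by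
  have h := setIntegral_linear_change (a := -1) (b := 0) (c := 0) (d := -1) (by norm_num) K F 0 0
  have he : ∀ q : ℝ × ℝ, ((-1 * q.1 + 0 * q.2 + 0, 0 * q.1 + -1 * q.2 + 0) : ℝ × ℝ) = -q := by
    intro q
    ext <;> simp
  simp only [he, hF, integral_neg] at h
  have hs : (fun q : ℝ × ℝ => -q) ⁻¹' K = K := by
    ext q
    exact hsym q
  rw [hs] at h
  norm_num at h
  linarith

theorem isoC_of_symm {K : Set (ℝ × ℝ)} (hsym : ∀ q, -q ∈ K ↔ q ∈ K) :
    isoC K = (volume K).toReal ^ 2 / (((∫ q in K, q.1 * q.1) * (∫ q in K, q.2 * q.2) -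
      (∫ q in K, q.1 * q.2) ^ 2) / (volume K).toReal ^ 2) := by
  have hb : ∀ i, bary2 K i = 0 := by
    intro i
    rw [bary2, setIntegral_odd_eq_zero hsym, zero_div]
    intro q
    unfold coord2
    split_ifs <;> simp
  have hcomm : ∫ q in K, q.2 * q.1 = ∫ q in K, q.1 * q.2 := by
    simp only [mul_comm]
  unfold isoC cov2
  simp only [Matrix.det_fin_two, Matrix.of_apply, hb, coord2, if_true, one_ne_zero, if_false,
    mul_zero, sub_zero, hcomm]
  congr 1
  ring

theorem setIntegral_square_mul (f g : ℝ → ℝ) :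
    ∫ q in Icc ((-1 : ℝ), (-1 : ℝ)) (1, 1), f q.1 * g q.2 =
      (∫ x in (-1 : ℝ)..1, f x) * ∫ x in (-1 : ℝ)..1, g x := by
  rw [← Icc_prod_Icc, Measure.volume_eq_prod, setIntegral_prod_mul, integral_Icc_eq_integral_Ioc,
    integral_Icc_eq_integral_Ioc, intervalIntegral.integral_of_le (by norm_num),
    intervalIntegral.integral_of_le (by norm_num)]

theorem isoC_square : isoC (Icc ((-1 : ℝ), (-1 : ℝ)) (1, 1)) = 144 := by
  rw [isoC_of_symm]
  · have h0 : ∫ _ in (-1 : ℝ)..1, (1 : ℝ) = 2 := by norm_num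
    have h1 : ∫ x in (-1 : ℝ)..1, x = 0 := by norm_num
    have h2 : ∫ x in (-1 : ℝ)..1, x * x = 2 / 3 := by
      simp only [← sq, integral_pow]
      norm_num
    have hv : (volume (Icc ((-1 : ℝ), (-1 : ℝ)) (1, 1))).toReal = 4 := by
      have := setIntegral_square_mul (fun _ => 1) (fun _ => 1)
      rw [h0] at this
      simp only [mul_one, integral_const, MeasurableSet.univ, measureReal_restrict_apply,
        univ_inter, smul_eq_mul] at this
      rw [← measureReal_def, this]
      norm_num
    have e11 := setIntegral_square_mul (fun x => x * x) (fun _ => 1)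
    have e22 := setIntegral_square_mul (fun _ => 1) (fun x => x * x)
    have e12 := setIntegral_square_mul (fun x => x) (fun x => x)
    rw [h0, h2] at e11 e22
    rw [h1] at e12
    simp only [mul_one, one_mul] at e11 e22 e12
    rw [hv, e11, e22, e12]
    norm_num
  · rintro ⟨x, y⟩
    simp only [Prod.neg_mk, mem_Icc, Prod.mk_le_mk]
    constructor <;> rintro ⟨⟨h1, h2⟩, h3, h4⟩ <;> refine ⟨⟨?_, ?_⟩, ?_, ?_⟩ <;> linarith

/-- Theorem 1.14, strong symmetric slicing conjecture in the plane:
every symmetric convex body `K ⊆ ℝ²` satisfies `C(K) ≥ 144`, with `C([-1,1]²) = 144`. -/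
theorem strong_slicing_sym_two_dim :
    (∀ K : Set (ℝ × ℝ), IsCompact K → Convex ℝ K → (interior K).Nonempty → K = -K →
      (144 : ℝ) ≤ isoC K) ∧ isoC (Set.Icc ((-1 : ℝ), (-1 : ℝ)) (1, 1)) = 144 := by
  refine ⟨fun K hK hc hne hneg => ?_, isoC_square⟩
  have hsym : ∀ q, -q ∈ K ↔ q ∈ K := fun q => by
    conv_rhs => rw [hneg]
    exact Iff.rfl
  have h0 : (0 : ℝ × ℝ) ∈ interior K := by
    obtain ⟨x, hx⟩ := hne
    have hx' : -x ∈ interior K := by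
      rw [hneg]
      have h := (Homeomorph.neg (ℝ × ℝ)).preimage_interior K
      exact h.subset (by simpa using hx)
    have h := hc.interior hx hx' (by norm_num : (0 : ℝ) ≤ 1 / 2) (by norm_num : (0 : ℝ) ≤ 1 / 2)
      (by norm_num)
    simpa using h
  have hvol : ∫ _ in K, (1 : ℝ) = (volume K).toReal := by
    simp [measureReal_def]
  have hV : 0 < (volume K).toReal := ENNReal.toReal_pos
    (Measure.measure_pos_of_nonempty_interior _ ⟨0, h0⟩).ne' hK.measure_lt_top.ne
  have hle := second_moment_det_le hK hc hsym h0 (by rwa [hvol])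
  have hpos := second_moment_det_pos hK (by rwa [hvol])
  rw [hvol] at hle
  rw [isoC_of_symm hsym, div_div_eq_mul_div, le_div_iff₀ hpos]
  linarith [pow_add (volume K).toReal 2 2]
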